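/- arXiv:1303.7349 — 2 statements merged into one kernel-verified Lean document; each statement's English description precedes it below -/
import Mathlib

section
/- In the stable-like setting on ℝ^m with logarithmic weight, let ε ∈ (0,1) and let φ : [0,∞) → [0,∞) be any increasing function with φ(r) → ∞ as r → ∞. Then there exists a Borel function V : ℝ^m → ℝ with ε log log(e+|x|) ≤ V(x) ≤ ε log log(e+|x|) + φ(|x|) for all x and ∫ e^V dμ < ∞, such that for μ_V := e^V·μ / μ(e^V) and ℰ_V(f) := ∫ Γ(f) dμ_V, the super Poincaré inequality with rate β_V(r) = exp(C₁(1 + r^{−1/(1−ε)})) fails for every C₁ > 0: for every C₁ > 0 there exist r > 0 and f ∈ 𝒜 with μ_V(f²) > r ℰ_V(f) + exp(C₁(1 + r^{−1/(1−ε)})) μ_V(|f|)². -/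
open MeasureTheory Filter
open scoped ENNReal

theorem exp_rate_mul_rpow_eventually_lt {ψ : ℝ → ℝ} (hψ : Tendsto ψ atTop atTop) {α ε C k K : ℝ}
    (hα : 0 < α) (hε : ε < 1) (hk : 0 < k) (hK : 0 < K) :
    ∀ᶠ R in atTop, Real.exp (C * (1 + (k * Real.log (5 * R) ^ (-(1 - ε)) * Real.exp (ψ R)) ^
      (-(1 / (1 - ε))))) * (K * R ^ (-(α / 2))) < 1 / 2 := by
  have h1ε : 0 < 1 - ε := by linarith
  set p : ℝ := 1 / (1 - ε) with hp
  have hp0 : 0 < p := by positivity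
  have hsmall : Tendsto (fun R => C * k ^ (-p) * Real.exp (-(p * ψ R))) atTop (nhds 0) := by
    have : Tendsto (fun R => Real.exp (-(p * ψ R))) atTop (nhds 0) :=
      Real.tendsto_exp_neg_atTop_nhds_zero.comp (hψ.const_mul_atTop hp0)
    simpa using this.const_mul (C * k ^ (-p))
  have hdecay : Tendsto (fun R : ℝ => Real.exp (C + α / 4 * Real.log 5) * K * R ^ (-(α / 4)))
      atTop (nhds 0) := by
    simpa using (tendsto_rpow_neg_atTop (show 0 < α / 4 by positivity)).const_mul
      (Real.exp (C + α / 4 * Real.log 5) * K)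
  filter_upwards [hsmall.eventually_le_const (show 0 < α / 4 by positivity),
    hdecay.eventually_lt_const (show (0 : ℝ) < 1 / 2 by norm_num), eventually_ge_atTop 1]
    with R h1 h2 hR
  have hR0 : 0 < R := by linarith
  have hL : 0 < Real.log (5 * R) := Real.log_pos (by linarith)
  have hrate : (k * Real.log (5 * R) ^ (-(1 - ε)) * Real.exp (ψ R)) ^ (-p)
      = k ^ (-p) * Real.log (5 * R) * Real.exp (-(p * ψ R)) := by
    rw [Real.mul_rpow (by positivity) (by positivity), Real.mul_rpow hk.le (by positivity),
      ← Real.rpow_mul hL.le, ← Real.exp_mul]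
    have : -(1 - ε) * -p = 1 := by rw [hp]; field_simp
    rw [this, Real.rpow_one]
    ring_nf
  rw [hrate]
  refine lt_of_le_of_lt ?_ h2
  have hexp : C * (1 + k ^ (-p) * Real.log (5 * R) * Real.exp (-(p * ψ R)))
      ≤ C + α / 4 * Real.log 5 + α / 4 * Real.log R := by
    have := mul_le_mul_of_nonneg_right h1 hL.le
    rw [Real.log_mul (by norm_num) hR0.ne'] at *
    linarith
  calc _ ≤ Real.exp (C + α / 4 * Real.log 5 + α / 4 * Real.log R) * (K * R ^ (-(α / 2))) := by
        gcongr
    _ = Real.exp (C + α / 4 * Real.log 5) * K * (R ^ (α / 4) * R ^ (-(α / 2))) := by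
        rw [Real.exp_add _ (α / 4 * Real.log R), Real.rpow_def_of_pos hR0 (α / 4)]
        ring_nf
    _ = _ := by
        rw [← Real.rpow_add hR0]
        ring_nf

theorem integrable_min_one_sq_div_rpow {m : ℕ} (hm : 1 ≤ m) {α : ℝ} (hα0 : 0 < α) (hα2 : α < 2) :
    Integrable (fun z : EuclideanSpace ℝ (Fin m) =>
      min 1 (‖z‖ ^ 2) / ‖z‖ ^ ((m : ℝ) + α)) volume := by
  have : Nonempty (Fin m) := ⟨⟨0, hm⟩⟩
  have key := (integrable_fun_norm_addHaar (volume : Measure (EuclideanSpace ℝ (Fin m)))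
    (f := fun t : ℝ => min 1 (t ^ 2) / t ^ ((m : ℝ) + α))).2
  refine key ?_
  rw [finrank_euclideanSpace_fin, ← Set.Ioc_union_Ioi_eq_Ioi zero_le_one]
  have hpow : ∀ t : ℝ, 0 < t → t ^ (m - 1) / t ^ ((m : ℝ) + α) = t ^ (-1 - α) := by
    intro t ht
    rw [← Real.rpow_natCast, ← Real.rpow_sub ht, Nat.cast_sub hm]
    congr 1
    push_cast
    ring
  refine IntegrableOn.union ?_ ?_
  · have h := intervalIntegral.intervalIntegrable_rpow' (a := 0) (b := 1)
      (show -1 < 1 - α by linarith)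
    rw [intervalIntegrable_iff_integrableOn_Ioc_of_le zero_le_one] at h
    refine h.congr_fun (fun t ht => ?_) measurableSet_Ioc
    simp only [smul_eq_mul]
    rw [min_eq_right (pow_le_one₀ ht.1.le ht.2), ← mul_div_assoc, mul_comm, mul_div_assoc,
      hpow t ht.1, ← Real.rpow_natCast, ← Real.rpow_add ht.1]
    congr 1
    push_cast
    ring
  · refine (integrableOn_Ioi_rpow_of_lt (show -1 - α < -1 by linarith) zero_lt_one).congr_fun
      (fun t ht => ?_) measurableSet_Ioi
    have ht : 1 < t := ht
    simp only [smul_eq_mul]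
    rw [min_eq_left (one_le_pow₀ ht.le), mul_one_div, hpow t (by linarith)]

/-- The radial cutoff that vanishes on the ball of radius `R` and is `1` outside the ball of
radius `2 * R`. -/
noncomputable def radialCutoff {E : Type*} [NormedAddCommGroup E] (R : ℝ) (x : E) : ℝ :=
  min 1 (max 0 (‖x‖ / R - 1))

section radialCutoff

variable {E : Type*} [NormedAddCommGroup E] {R : ℝ}

theorem radialCutoff_nonneg (x : E) : 0 ≤ radialCutoff R x :=
  le_min zero_le_one (le_max_left _ _)

theorem radialCutoff_le_one (x : E) : radialCutoff R x ≤ 1 := min_le_left _ _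

theorem continuous_radialCutoff : Continuous (radialCutoff R : E → ℝ) := by
  unfold radialCutoff
  fun_prop

theorem radialCutoff_eq_zero (hR : 0 < R) {x : E} (hx : ‖x‖ ≤ R) : radialCutoff R x = 0 := by
  have : ‖x‖ / R ≤ 1 := (div_le_one hR).2 hx
  rw [radialCutoff, max_eq_left (by linarith), min_eq_right zero_le_one]

theorem radialCutoff_eq_one (hR : 0 < R) {x : E} (hx : 2 * R ≤ ‖x‖) : radialCutoff R x = 1 := by
  have : 2 ≤ ‖x‖ / R := (le_div_iff₀ hR).2 hx
  rw [radialCutoff, min_eq_left (le_max_of_le_right (by linarith))]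

theorem abs_radialCutoff_sub_le (hR : 0 < R) (x y : E) :
    |radialCutoff R x - radialCutoff R y| ≤ ‖x - y‖ / R := by
  have h : |radialCutoff R x - radialCutoff R y| ≤ |(‖x‖ / R - 1) - (‖y‖ / R - 1)| := by
    unfold radialCutoff
    refine (abs_min_sub_min_le_max _ _ _ _).trans ?_
    rw [sub_self, abs_zero, max_eq_right (abs_nonneg _)]
    refine (abs_max_sub_max_le_max _ _ _ _).trans ?_
    rw [sub_self, abs_zero, max_eq_right (abs_nonneg _)]
  refine h.trans ?_
  rw [sub_sub_sub_cancel_right, ← sub_div, abs_div, abs_of_pos hR]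
  gcongr
  exact abs_norm_sub_norm_le x y

theorem sq_radialCutoff_sub_le (hR : 0 < R) (x y : E) :
    (radialCutoff R x - radialCutoff R y) ^ 2 ≤ min 1 ((‖x - y‖ / R) ^ 2) := by
  rw [← sq_abs]
  refine le_min ?_ (pow_le_pow_left₀ (abs_nonneg _) (abs_radialCutoff_sub_le hR x y) 2)
  refine pow_le_one₀ (abs_nonneg _) (abs_le.2 ⟨?_, ?_⟩) <;>
  linarith [radialCutoff_nonneg (R := R) x, radialCutoff_nonneg (R := R) y,
    radialCutoff_le_one (R := R) x, radialCutoff_le_one (R := R) y]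

end radialCutoff

theorem integrable_scaled_min_one_sq_div_rpow {m : ℕ} (hm : 1 ≤ m) {α : ℝ} (hα0 : 0 < α)
    (hα2 : α < 2) {R : ℝ} (hR : 0 < R) (x : EuclideanSpace ℝ (Fin m)) :
    Integrable (fun y => min 1 ((‖x - y‖ / R) ^ 2) / ‖x - y‖ ^ ((m : ℝ) + α)) volume ∧
    ∫ y, min 1 ((‖x - y‖ / R) ^ 2) / ‖x - y‖ ^ ((m : ℝ) + α) =
      R ^ (-α) * ∫ z : EuclideanSpace ℝ (Fin m), min 1 (‖z‖ ^ 2) / ‖z‖ ^ ((m : ℝ) + α) := by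
  set g : EuclideanSpace ℝ (Fin m) → ℝ := fun z => min 1 (‖z‖ ^ 2) / ‖z‖ ^ ((m : ℝ) + α) with hg
  have hscale : ∀ z : EuclideanSpace ℝ (Fin m),
      min 1 ((‖z‖ / R) ^ 2) / ‖z‖ ^ ((m : ℝ) + α) = R ^ (-((m : ℝ) + α)) * g (R⁻¹ • z) := by
    intro z
    have hnorm : ‖R⁻¹ • z‖ = ‖z‖ / R := by
      rw [norm_smul, Real.norm_of_nonneg (by positivity), inv_mul_eq_div]
    simp only [hg, hnorm]
    rw [Real.div_rpow (norm_nonneg _) hR.le, Real.rpow_neg hR.le]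
    have : R ^ ((m : ℝ) + α) ≠ 0 := by positivity
    field_simp
  have hint : Integrable (fun z => R ^ (-((m : ℝ) + α)) * g (R⁻¹ • z)) volume :=
    ((integrable_min_one_sq_div_rpow hm hα0 hα2).comp_smul (inv_ne_zero hR.ne')).const_mul _
  simp_rw [fun y => hscale (x - y)]
  refine ⟨hint.comp_sub_left x, ?_⟩
  rw [integral_sub_left_eq_self (fun z => R ^ (-((m : ℝ) + α)) * g (R⁻¹ • z)),
    integral_const_mul, Measure.integral_comp_inv_smul, finrank_euclideanSpace_fin,
    abs_of_pos (by positivity), smul_eq_mul, ← mul_assoc, ← Real.rpow_natCast,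
    ← Real.rpow_add hR]
  congr 2
  ring

theorem sq_integral_abs_le_of_tail {E : Type*} [MeasurableSpace E] {ν : Measure E}
    [IsFiniteMeasure ν] {f : E → ℝ} (hf : Integrable f ν) (hf2 : Integrable (fun x => f x ^ 2) ν)
    {S : Set E} (hS : MeasurableSet S) (hfS : ∀ x, x ∉ S → f x = 0) {P : ℝ} (hP : 0 < P)
    (hSP : ν.real S ≤ P) :
    (∫ x, |f x| ∂ν) ^ 2 ≤ P * ∫ x, f x ^ 2 ∂ν := by
  set t := ∫ x, |f x| ∂ν
  have hone : Integrable (S.indicator fun _ => (1 : ℝ)) ν := (integrable_const 1).indicator hS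
  have hexpand : ∫ x, (f x ^ 2 - 2 * (t / P) * |f x| + (t / P) ^ 2 * S.indicator (fun _ => 1) x) ∂ν
      = ∫ x, f x ^ 2 ∂ν - 2 * (t / P) * t + (t / P) ^ 2 * ν.real S := by
    have hsub : Integrable (fun x => f x ^ 2 - 2 * (t / P) * |f x|) ν :=
      hf2.sub (hf.abs.const_mul _)
    rw [integral_add hsub (hone.const_mul _), integral_sub hf2 (hf.abs.const_mul _), integral_const_mul, integral_const_mul,
      integral_indicator_const _ hS]
    simp [t]
  have hnonneg : 0 ≤ ∫ x, (f x ^ 2 - 2 * (t / P) * |f x|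
      + (t / P) ^ 2 * S.indicator (fun _ => 1) x) ∂ν := by
    refine integral_nonneg fun x => ?_
    by_cases hx : x ∈ S
    · simp only [Set.indicator_of_mem hx, Pi.zero_apply]
      nlinarith [sq_nonneg (|f x| - t / P), sq_abs (f x)]
    · simp [Set.indicator_of_notMem hx, hfS x hx]
  rw [hexpand] at hnonneg
  have h1 : (t / P) ^ 2 * ν.real S ≤ (t / P) ^ 2 * P := by gcongr
  have h2 : (t / P) ^ 2 * P = t ^ 2 / P := by field_simp
  have h3 : 2 * (t / P) * t = 2 * (t ^ 2 / P) := by ring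
  have h4 : t ^ 2 / P ≤ ∫ x, f x ^ 2 ∂ν := by linarith
  rw [div_le_iff₀ hP] at h4
  linarith

theorem withDensity_real_le {E : Type*} [MeasurableSpace E] {ν : Measure E} {w g : E → ℝ}
    (hg : Integrable g ν) (hg0 : ∀ x, 0 ≤ g x) {S : Set E} (hS : MeasurableSet S)
    (h : ∀ x ∈ S, w x ≤ g x) :
    (ν.withDensity fun x => ENNReal.ofReal (w x)).real S ≤ ∫ x, g x ∂ν := by
  refine ENNReal.toReal_le_of_le_ofReal (integral_nonneg hg0) ?_
  rw [withDensity_apply _ hS, ofReal_integral_eq_lintegral_ofReal hg (ae_of_all _ hg0)]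
  exact (setLIntegral_mono' hS fun x hx => ENNReal.ofReal_le_ofReal (h x hx)).trans
    (setLIntegral_le_lintegral _ _)

theorem le_withDensity_real {E : Type*} [MeasurableSpace E] {ν : Measure E} {w : E → ℝ}
    [IsFiniteMeasure (ν.withDensity fun x => ENNReal.ofReal (w x))]
    {S : Set E} (hS : MeasurableSet S) {b : ℝ} (hb : 0 ≤ b) (h : ∀ x ∈ S, b ≤ w x) :
    b * ν.real S ≤ (ν.withDensity fun x => ENNReal.ofReal (w x)).real S := by
  rw [Measure.real, Measure.real, ← ENNReal.toReal_ofReal hb, ← ENNReal.toReal_mul]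
  refine ENNReal.toReal_mono (measure_ne_top _ _) ?_
  rw [withDensity_apply _ hS, ← setLIntegral_const]
  exact setLIntegral_mono' hS fun x hx => ENNReal.ofReal_le_ofReal (h x hx)

theorem carreDuChamp_radialCutoff_le {m : ℕ} (hm : 1 ≤ m) {α : ℝ} (hα0 : 0 < α) (hα2 : α < 2)
    {c : ℝ} (hc : 0 < c) {R : ℝ} (hR : 0 < R) (x : EuclideanSpace ℝ (Fin m)) :
    ∫ y, (radialCutoff R x - radialCutoff R y) ^ 2 *
        ((1 + ‖y‖) ^ ((m : ℝ) + α) * Real.log (1 + ‖y‖) / ‖x - y‖ ^ ((m : ℝ) + α))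
      ∂(volume.withDensity fun x : EuclideanSpace ℝ (Fin m) =>
        ENNReal.ofReal (c / ((1 + ‖x‖) ^ ((m : ℝ) + α) * Real.log (1 + ‖x‖)))) ≤
      (c * ∫ z : EuclideanSpace ℝ (Fin m), min 1 (‖z‖ ^ 2) / ‖z‖ ^ ((m : ℝ) + α)) * R ^ (-α) := by
  rw [integral_withDensity_eq_integral_toReal_smul (by fun_prop)
    (ae_of_all _ fun _ => ENNReal.ofReal_lt_top)]
  obtain ⟨hint, heq⟩ := integrable_scaled_min_one_sq_div_rpow hm hα0 hα2 hR x
  rw [mul_assoc, mul_comm _ (R ^ (-α)), ← heq, ← integral_const_mul]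
  have hlog : ∀ y : EuclideanSpace ℝ (Fin m), 0 ≤ Real.log (1 + ‖y‖) := fun y =>
    Real.log_nonneg (by linarith [norm_nonneg y])
  refine integral_mono_of_nonneg (ae_of_all _ fun y => ?_) (hint.const_mul c)
    (ae_of_all _ fun y => ?_)
  · have := hlog y
    simp only [Pi.zero_apply, smul_eq_mul]
    positivity
  · have hy := hlog y
    have hd : 0 ≤ c / ((1 + ‖y‖) ^ ((m : ℝ) + α) * Real.log (1 + ‖y‖)) := by positivity
    simp only [smul_eq_mul, ENNReal.toReal_ofReal hd]
    have hsq := sq_radialCutoff_sub_le hR x y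
    have hcancel : c / ((1 + ‖y‖) ^ ((m : ℝ) + α) * Real.log (1 + ‖y‖)) *
        ((1 + ‖y‖) ^ ((m : ℝ) + α) * Real.log (1 + ‖y‖)) ≤ c := by
      by_cases h0 : (1 + ‖y‖) ^ ((m : ℝ) + α) * Real.log (1 + ‖y‖) = 0
      · rw [h0, mul_zero]
        exact hc.le
      · rw [div_mul_cancel₀ _ h0]
    calc _ = c / ((1 + ‖y‖) ^ ((m : ℝ) + α) * Real.log (1 + ‖y‖)) *
          ((1 + ‖y‖) ^ ((m : ℝ) + α) * Real.log (1 + ‖y‖)) *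
          ((radialCutoff R x - radialCutoff R y) ^ 2 / ‖x - y‖ ^ ((m : ℝ) + α)) := by ring
      _ ≤ c * (min 1 ((‖x - y‖ / R) ^ 2) / ‖x - y‖ ^ ((m : ℝ) + α)) := by gcongr

theorem one_le_log_exp_one_add {t : ℝ} (ht : 0 ≤ t) : 1 ≤ Real.log (Real.exp 1 + t) := by
  rw [Real.le_log_iff_exp_le (by positivity)]
  linarith

theorem log_exp_one_add_le {t : ℝ} (ht : 0 ≤ t) :
    Real.log (Real.exp 1 + t) ≤ 1 + Real.log (1 + t) := by
  have h1 : (1 : ℝ) ≤ Real.exp 1 := Real.one_le_exp zero_le_one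
  calc Real.log (Real.exp 1 + t) ≤ Real.log (Real.exp 1 * (1 + t)) := by
        refine Real.log_le_log (by positivity) ?_
        nlinarith
    _ = 1 + Real.log (1 + t) := by
        rw [Real.log_mul (by positivity) (by positivity), Real.log_exp]

/-- The largest admissible perturbation below `φ` that keeps `exp V` below `log (e + ‖x‖)`. -/
noncomputable def truncatedPerturbation (φ : ℝ → ℝ) (ε s : ℝ) : ℝ :=
  min (φ s) ((1 - ε) * Real.log (Real.log (Real.exp 1 + s)))

section truncatedPerturbation

variable {φ : ℝ → ℝ} {ε : ℝ}

theorem truncatedPerturbation_nonneg (hφ : ∀ r, 0 ≤ φ r) (hε : ε < 1) {s : ℝ} (hs : 0 ≤ s) :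
    0 ≤ truncatedPerturbation φ ε s :=
  le_min (hφ s) (mul_nonneg (by linarith) (Real.log_nonneg (one_le_log_exp_one_add hs)))

theorem truncatedPerturbation_mono (hφ : Monotone φ) (hε : ε < 1) {s t : ℝ} (hs : 0 ≤ s)
    (hst : s ≤ t) : truncatedPerturbation φ ε s ≤ truncatedPerturbation φ ε t := by
  refine min_le_min (hφ hst) (mul_le_mul_of_nonneg_left ?_ (by linarith))
  have h1 := one_le_log_exp_one_add hs
  refine Real.log_le_log (by linarith) (Real.log_le_log (by positivity) (by linarith))

theorem tendsto_truncatedPerturbation (hφ : Tendsto φ atTop atTop) (hε : ε < 1) :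
    Tendsto (truncatedPerturbation φ ε) atTop atTop := by
  have hll : Tendsto (fun s => (1 - ε) * Real.log (Real.log (Real.exp 1 + s))) atTop atTop :=
    (Real.tendsto_log_atTop.comp (Real.tendsto_log_atTop.comp
      (tendsto_atTop_add_const_left _ _ tendsto_id))).const_mul_atTop (by linarith)
  refine tendsto_atTop.2 fun b => ?_
  filter_upwards [hφ.eventually_ge_atTop b, hll.eventually_ge_atTop b] with s h1 h2
  exact le_min h1 h2

theorem measurable_truncatedPerturbation (hφ : Monotone φ) :
    Measurable (truncatedPerturbation φ ε) := by
  have := hφ.measurable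
  unfold truncatedPerturbation
  fun_prop

theorem exp_potential_le {s : ℝ} (hs : 0 ≤ s) :
    Real.exp (ε * Real.log (Real.log (Real.exp 1 + s)) + truncatedPerturbation φ ε s) ≤
      Real.log (Real.exp 1 + s) := by
  have h1 := one_le_log_exp_one_add hs
  rw [← Real.le_log_iff_exp_le (by linarith)]
  have := min_le_right (φ s) ((1 - ε) * Real.log (Real.log (Real.exp 1 + s)))
  unfold truncatedPerturbation
  linarith

/-- Lower bound of the density of `exp V · μ` on the annulus `R ≤ s ≤ 4 R`. -/
theorem le_density_mul_exp_potential (hφ : Monotone φ) (hε : ε < 1) {c p R s : ℝ}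
    (hε0 : 0 < ε) (hc : 0 < c) (hp : 0 < p) (hR : 1 ≤ R) (hRs : R ≤ s) (hs : s ≤ 4 * R) :
    c * (5 * R) ^ (-p) * (Real.log (5 * R) ^ (-(1 - ε)) *
        Real.exp (truncatedPerturbation φ ε R)) ≤
      c / ((1 + s) ^ p * Real.log (1 + s)) *
        Real.exp (ε * Real.log (Real.log (Real.exp 1 + s)) + truncatedPerturbation φ ε s) := by
  have hL : 0 < Real.log (1 + s) := Real.log_pos (by linarith)
  have he : (1 : ℝ) ≤ Real.exp 1 := Real.one_le_exp zero_le_one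
  have hpow : (5 * R) ^ (-p) ≤ ((1 + s) ^ p)⁻¹ := by
    rw [← Real.rpow_neg (by linarith)]
    exact Real.rpow_le_rpow_of_nonpos (by linarith) (by linarith) (by linarith)
  have hlog : Real.log (5 * R) ^ (-(1 - ε)) ≤ (Real.log (1 + s))⁻¹ * Real.log (1 + s) ^ ε := by
    rw [← Real.rpow_neg_one, ← Real.rpow_add hL]
    rw [show -(1 - ε) = -1 + ε by ring]
    exact Real.rpow_le_rpow_of_nonpos hL (Real.log_le_log (by linarith) (by linarith))
      (by linarith)
  have hexp : Real.log (1 + s) ^ ε ≤ Real.exp (ε * Real.log (Real.log (Real.exp 1 + s))) := by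
    rw [Real.rpow_def_of_pos hL, mul_comm]
    refine Real.exp_le_exp.2 (mul_le_mul_of_nonneg_left ?_ hε0.le)
    exact Real.log_le_log hL (Real.log_le_log (by linarith) (by linarith))
  have hψ := truncatedPerturbation_mono hφ hε (by linarith : 0 ≤ R) hRs
  have hs1 : 0 ≤ 1 + s := by linarith
  have hR5 : 0 < Real.log (5 * R) := Real.log_pos (by linarith)
  calc _ ≤ c * ((1 + s) ^ p)⁻¹ * (((Real.log (1 + s))⁻¹ *
        Real.exp (ε * Real.log (Real.log (Real.exp 1 + s)))) *
        Real.exp (truncatedPerturbation φ ε s)) := by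
        gcongr
        exact hlog.trans (by gcongr)
    _ = _ := by
        rw [Real.exp_add]
        field_simp

/-- Upper bound of the density of `exp V · μ` away from the origin. -/
theorem density_mul_exp_potential_le {c p R s a : ℝ} (hc : 0 < c) (ha : 0 ≤ a)
    (hR : Real.exp 1 ≤ R) (hs : R ≤ s) :
    c / ((1 + s) ^ p * Real.log (1 + s)) *
        Real.exp (ε * Real.log (Real.log (Real.exp 1 + s)) + truncatedPerturbation φ ε s) ≤
      2 * c * R ^ (-a) * (1 + s) ^ (-(p - a)) := by
  have he : (1 : ℝ) ≤ Real.exp 1 := Real.one_le_exp zero_le_one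
  have hL : 1 ≤ Real.log (1 + s) := by
    rw [Real.le_log_iff_exp_le (by linarith)]
    linarith
  have hs0 : 0 < 1 + s := by linarith
  have hV : Real.exp (ε * Real.log (Real.log (Real.exp 1 + s)) + truncatedPerturbation φ ε s) ≤
      2 * Real.log (1 + s) := by
    have := (exp_potential_le (φ := φ) (ε := ε) (by linarith : 0 ≤ s)).trans
      (log_exp_one_add_le (by linarith))
    linarith
  have hpow : (1 + s) ^ (-a) ≤ R ^ (-a) :=
    Real.rpow_le_rpow_of_nonpos (by linarith) (by linarith) (by linarith)
  calc _ ≤ c / ((1 + s) ^ p * Real.log (1 + s)) * (2 * Real.log (1 + s)) := by gcongr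
    _ = 2 * c * (1 + s) ^ (-a + -(p - a)) := by
        rw [show -a + -(p - a) = -p by ring, Real.rpow_neg hs0.le]
        field_simp
    _ = 2 * c * (1 + s) ^ (-a) * (1 + s) ^ (-(p - a)) := by
        rw [Real.rpow_add hs0]
        ring
    _ ≤ _ := by gcongr

end truncatedPerturbation

theorem integrable_exp_potential {m : ℕ} {α c ε : ℝ} {φ : ℝ → ℝ} (hα0 : 0 < α) (hc : 0 < c)
    (hφ : Monotone φ) {μ : Measure (EuclideanSpace ℝ (Fin m))} [IsFiniteMeasure μ]
    (hμ : μ = volume.withDensity fun x =>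
      ENNReal.ofReal (c / ((1 + ‖x‖) ^ ((m : ℝ) + α) * Real.log (1 + ‖x‖)))) :
    Integrable (fun x => Real.exp (ε * Real.log (Real.log (Real.exp 1 + ‖x‖)) +
      truncatedPerturbation φ ε ‖x‖)) μ := by
  have hψ := measurable_truncatedPerturbation (ε := ε) hφ
  set d : EuclideanSpace ℝ (Fin m) → ℝ :=
    fun x => c / ((1 + ‖x‖) ^ ((m : ℝ) + α) * Real.log (1 + ‖x‖)) with hd
  have hlog : ∀ x : EuclideanSpace ℝ (Fin m), 0 ≤ Real.log (1 + ‖x‖) := fun x =>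
    Real.log_nonneg (by linarith [norm_nonneg x])
  have hd0 : ∀ x, 0 ≤ d x := fun x => by
    have := hlog x
    positivity
  have hdm : Measurable fun x => ENNReal.ofReal (d x) := by fun_prop
  have hiff : ∀ g : EuclideanSpace ℝ (Fin m) → ℝ,
      Integrable g μ ↔ Integrable (fun x => d x * g x) volume := by
    intro g
    rw [hμ, integrable_withDensity_iff_integrable_smul' hdm
      (ae_of_all _ fun _ => ENNReal.ofReal_lt_top)]
    simp only [ENNReal.toReal_ofReal (hd0 _), smul_eq_mul]
  have hdint : Integrable d volume := by
    simpa using (hiff fun _ => 1).1 (integrable_const 1)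
  have htail : Integrable (fun x : EuclideanSpace ℝ (Fin m) =>
      c * (1 + ‖x‖) ^ (-((m : ℝ) + α))) volume :=
    (integrable_one_add_norm (by rw [finrank_euclideanSpace_fin]; linarith)).const_mul c
  refine (hiff _).2 ((hdint.add htail).mono' (by fun_prop) (ae_of_all _ fun x => ?_))
  have hx := hd0 x
  have hL := hlog x
  rw [Real.norm_of_nonneg (by positivity)]
  have hcancel : d x * Real.log (1 + ‖x‖) ≤ c * (1 + ‖x‖) ^ (-((m : ℝ) + α)) := by
    rw [Real.rpow_neg (by positivity), hd]
    rcases hL.eq_or_lt with h0 | h0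
    · rw [← h0, mul_zero]
      positivity
    · refine le_of_eq ?_
      field_simp
  calc _ ≤ d x * (1 + Real.log (1 + ‖x‖)) := by
        gcongr
        exact (exp_potential_le (norm_nonneg x)).trans (log_exp_one_add_le (norm_nonneg x))
    _ ≤ d x + c * (1 + ‖x‖) ^ (-((m : ℝ) + α)) := by linarith

theorem exists_ball_subset_annulus {m : ℕ} (hm : 1 ≤ m) {R : ℝ} (hR : 0 < R) :
    ∃ x₀ : EuclideanSpace ℝ (Fin m), ∀ x ∈ Metric.ball x₀ R, 2 * R ≤ ‖x‖ ∧ ‖x‖ ≤ 4 * R := by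
  have : Nonempty (Fin m) := ⟨⟨0, hm⟩⟩
  obtain ⟨x₀, hx₀⟩ := exists_norm_eq (EuclideanSpace ℝ (Fin m)) (by positivity : 0 ≤ 3 * R)
  refine ⟨x₀, fun x hx => ?_⟩
  rw [mem_ball_iff_norm] at hx
  have h := abs_le.1 (abs_norm_sub_norm_le x x₀)
  constructor <;> linarith [h.1, h.2]

theorem withDensity_normalized_eq {m : ℕ} {d V : EuclideanSpace ℝ (Fin m) → ℝ} {Z : ℝ}
    (hd : Measurable d) (hd0 : ∀ x, 0 ≤ d x) (hV : Measurable V) (hZ : 0 < Z) :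
    (ENNReal.ofReal Z)⁻¹ • (volume.withDensity fun x => ENNReal.ofReal (d x)).withDensity
        (fun x => ENNReal.ofReal (Real.exp (V x))) =
      volume.withDensity fun x => ENNReal.ofReal (Z⁻¹ * (d x * Real.exp (V x))) := by
  rw [← withDensity_mul _ (by fun_prop) (by fun_prop), ← withDensity_smul _ (by fun_prop)]
  congr 1
  funext x
  simp only [Pi.smul_apply, Pi.mul_apply, smul_eq_mul]
  rw [ENNReal.ofReal_mul (by positivity), ENNReal.ofReal_mul (hd0 x), ENNReal.ofReal_inv_of_pos hZ]

/-- Example 2.3(3): the constant K cannot be replaced by an unbounded function. -/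
theorem example_logWeight_superPoincare_sharp_unbounded
    {m : ℕ} (hm : 1 ≤ m)
    (α : ℝ) (hα0 : 0 < α) (hα2 : α < 2)
    (c : ℝ) (hc : 0 < c)
    (μ : MeasureTheory.Measure (EuclideanSpace ℝ (Fin m)))
    (hμ : μ = MeasureTheory.volume.withDensity fun x =>
      ENNReal.ofReal (c / ((1 + ‖x‖) ^ ((m : ℝ) + α) * Real.log (1 + ‖x‖))))
    [MeasureTheory.IsProbabilityMeasure μ]
    (q : EuclideanSpace ℝ (Fin m) → EuclideanSpace ℝ (Fin m) → ℝ)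
    (hq : ∀ x y, q x y =
      (1 + ‖y‖) ^ ((m : ℝ) + α) * Real.log (1 + ‖y‖) / ‖x - y‖ ^ ((m : ℝ) + α))
    (l : ℝ) (hl : ∀ x, ∫ y, min 1 (dist x y ^ 2) * q x y ∂μ ≤ l)
    (Γ : (EuclideanSpace ℝ (Fin m) → ℝ) → EuclideanSpace ℝ (Fin m) → ℝ)
    (hΓ : ∀ f x, Γ f x = ∫ y, (f x - f y) ^ 2 * q x y ∂μ)
    (A : Set (EuclideanSpace ℝ (Fin m) → ℝ))
    (hA : ∀ f, f ∈ A ↔ Measurable f ∧ (∃ M, ∀ x, |f x| ≤ M) ∧ ∃ M, ∀ x, Γ f x ≤ M)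
    (En : (EuclideanSpace ℝ (Fin m) → ℝ) → ℝ)
    (hEn : ∀ f, En f = ∫ x, Γ f x ∂μ)
    (εc : ℝ) (hεc0 : 0 < εc) (hεc1 : εc < 1)
    (φ : ℝ → ℝ) (hφ_nonneg : ∀ r, 0 ≤ φ r) (hφ_mono : Monotone φ)
    (hφ_inf : Tendsto φ atTop atTop) :
    ∃ V : EuclideanSpace ℝ (Fin m) → ℝ, Measurable V ∧
      (∀ x, εc * Real.log (Real.log (Real.exp 1 + ‖x‖)) ≤ V x ∧
        V x ≤ εc * Real.log (Real.log (Real.exp 1 + ‖x‖)) + φ ‖x‖) ∧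
      MeasureTheory.Integrable (fun x => Real.exp (V x)) μ ∧
      ∀ μV : MeasureTheory.Measure (EuclideanSpace ℝ (Fin m)),
        μV = (ENNReal.ofReal (∫ x, Real.exp (V x) ∂μ))⁻¹
          • μ.withDensity (fun x => ENNReal.ofReal (Real.exp (V x))) →
      ∀ EnV : (EuclideanSpace ℝ (Fin m) → ℝ) → ℝ, (∀ f, EnV f = ∫ x, Γ f x ∂μV) →
      ∀ C₁ : ℝ, 0 < C₁ → ∃ r : ℝ, 0 < r ∧ ∃ f ∈ A,
        r * EnV f + Real.exp (C₁ * (1 + r ^ (-(1 / (1 - εc))))) * (∫ x, |f x| ∂μV) ^ 2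
          < ∫ x, f x ^ 2 ∂μV := by
  have h1ε : 0 < 1 - εc := by linarith
  set V : EuclideanSpace ℝ (Fin m) → ℝ := fun x =>
    εc * Real.log (Real.log (Real.exp 1 + ‖x‖)) + truncatedPerturbation φ εc ‖x‖
  have hVm : Measurable V := by
    have := measurable_truncatedPerturbation (ε := εc) hφ_mono
    fun_prop
  have hVlow : ∀ x, εc * Real.log (Real.log (Real.exp 1 + ‖x‖)) ≤ V x := fun x =>
    le_add_of_nonneg_right (truncatedPerturbation_nonneg hφ_nonneg hεc1 (norm_nonneg x))
  have hVint : Integrable (fun x => Real.exp (V x)) μ :=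
    integrable_exp_potential hα0 hc hφ_mono hμ
  refine ⟨V, hVm, fun x => ⟨hVlow x, add_le_add_right (min_le_left _ _) _⟩, hVint, ?_⟩
  intro μV hμV EnV hEnV C₁ _
  set Z : ℝ := ∫ x, Real.exp (V x) ∂μ
  have hZ0 : 0 < Z := integral_exp_pos hVint
  have hprob : IsProbabilityMeasure μV := by
    constructor
    rw [hμV, Measure.smul_apply, withDensity_apply _ MeasurableSet.univ, Measure.restrict_univ,
      ← ofReal_integral_eq_lintegral_ofReal hVint (ae_of_all _ fun x => (Real.exp_pos _).le),
      smul_eq_mul]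
    exact ENNReal.inv_mul_cancel (by simpa using hZ0) ENNReal.ofReal_ne_top
  set d : EuclideanSpace ℝ (Fin m) → ℝ :=
    fun x => c / ((1 + ‖x‖) ^ ((m : ℝ) + α) * Real.log (1 + ‖x‖)) with hd
  have hd0 : ∀ x, 0 ≤ d x := fun x => by
    have : 0 ≤ Real.log (1 + ‖x‖) := Real.log_nonneg (by linarith [norm_nonneg x])
    positivity
  have hμV' : μV = volume.withDensity fun x => ENNReal.ofReal (Z⁻¹ * (d x * Real.exp (V x))) := by
    rw [hμV, ← withDensity_normalized_eq (by fun_prop) hd0 hVm hZ0, ← hμ]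
  -- the constants of the energy bound, of the tail bound and of the mass lower bound
  set Λ : ℝ := c * (∫ z : EuclideanSpace ℝ (Fin m), min 1 (‖z‖ ^ 2) / ‖z‖ ^ ((m : ℝ) + α)) + 1
  have hΛ0 : 0 < Λ := by
    have : 0 ≤ ∫ z : EuclideanSpace ℝ (Fin m), min 1 (‖z‖ ^ 2) / ‖z‖ ^ ((m : ℝ) + α) :=
      integral_nonneg fun z => by positivity
    positivity
  set I : ℝ := ∫ x : EuclideanSpace ℝ (Fin m), (1 + ‖x‖) ^ (-((m : ℝ) + α - α / 2))
  have hI0 : 0 ≤ I := integral_nonneg fun z => by positivity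
  set K : ℝ := Z⁻¹ * (2 * c) * I + 1 with hK
  have hK0 : 0 < K := by positivity
  set ω : ℝ := volume.real (Metric.ball (0 : EuclideanSpace ℝ (Fin m)) 1) with hω
  have hω0 : 0 < ω := ENNReal.toReal_pos (Metric.measure_ball_pos _ _ one_pos).ne'
    measure_ball_lt_top.ne
  set κ : ℝ := Z⁻¹ * c * 5 ^ (-((m : ℝ) + α)) * ω with hκ
  have hκ0 : 0 < κ := by positivity
  obtain ⟨R, hRlt, hRe⟩ := ((exp_rate_mul_rpow_eventually_lt
    (tendsto_truncatedPerturbation hφ_inf hεc1) (C := C₁) hα0 hεc1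
    (show 0 < κ / (2 * Λ) by positivity) hK0).and (eventually_ge_atTop (Real.exp 1))).exists
  have hR1 : 1 ≤ R := (Real.one_le_exp zero_le_one).trans hRe
  have hR0 : 0 < R := by linarith
  have hL : 0 < Real.log (5 * R) := Real.log_pos (by linarith)
  set G : ℝ := Real.log (5 * R) ^ (-(1 - εc)) * Real.exp (truncatedPerturbation φ εc R) with hG
  have hG0 : 0 < G := by positivity
  set f : EuclideanSpace ℝ (Fin m) → ℝ := radialCutoff R with hf
  have hfc : Continuous f := continuous_radialCutoff
  have hf0 : ∀ x, 0 ≤ f x := radialCutoff_nonneg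
  have hf1 : ∀ x, f x ≤ 1 := radialCutoff_le_one
  have hfint : Integrable f μV := Integrable.of_bound hfc.aestronglyMeasurable 1
    (ae_of_all _ fun x => by rw [Real.norm_of_nonneg (hf0 x)]; exact hf1 x)
  have hf2int : Integrable (fun x => f x ^ 2) μV :=
    Integrable.of_bound (hfc.pow 2).aestronglyMeasurable 1
      (ae_of_all _ fun x => by
        rw [Real.norm_of_nonneg (sq_nonneg _)]
        exact pow_le_one₀ (hf0 x) (hf1 x))
  have hΓle : ∀ x, Γ f x ≤ Λ * R ^ (-α) := by
    intro x
    rw [hΓ]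
    simp only [hq]
    rw [hμ]
    refine (carreDuChamp_radialCutoff_le hm hα0 hα2 hc hR0 x).trans ?_
    gcongr
    linarith
  have hq0 : ∀ x y, 0 ≤ q x y := fun x y => by
    have : 0 ≤ Real.log (1 + ‖y‖) := Real.log_nonneg (by linarith [norm_nonneg y])
    rw [hq]
    positivity
  have hΓ0 : ∀ x, 0 ≤ Γ f x := fun x => by
    rw [hΓ]
    exact integral_nonneg fun y => mul_nonneg (sq_nonneg _) (hq0 x y)
  have henergy : EnV f ≤ Λ * R ^ (-α) := by
    rw [hEnV]
    refine (integral_mono_of_nonneg (ae_of_all _ hΓ0) (integrable_const (Λ * R ^ (-α)))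
      (ae_of_all _ hΓle)).trans ?_
    simp
  have htail : μV.real {x | R ≤ ‖x‖} ≤ K * R ^ (-(α / 2)) := by
    have hpint : Integrable (fun x : EuclideanSpace ℝ (Fin m) =>
        (1 + ‖x‖) ^ (-((m : ℝ) + α - α / 2))) volume :=
      integrable_one_add_norm (by rw [finrank_euclideanSpace_fin]; linarith)
    rw [hμV']
    refine (withDensity_real_le (hpint.const_mul (Z⁻¹ * (2 * c * R ^ (-(α / 2)))))
      (fun x => by positivity) (measurableSet_le measurable_const measurable_norm)
      fun x hx => ?_).trans ?_
    · rw [mul_assoc]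
      refine mul_le_mul_of_nonneg_left ?_ (by positivity)
      exact density_mul_exp_potential_le hc (by positivity) hRe hx
    · rw [integral_const_mul, hK]
      have : 0 < R ^ (-(α / 2)) := by positivity
      linarith
  have hmass : κ * R ^ (-α) * G ≤ ∫ x, f x ^ 2 ∂μV := by
    obtain ⟨x₀, hx₀⟩ := exists_ball_subset_annulus hm hR0
    have hball : μV.real (Metric.ball x₀ R) ≤ ∫ x, f x ^ 2 ∂μV := by
      rw [← integral_indicator_one measurableSet_ball]
      refine integral_mono ((integrable_const 1).indicator measurableSet_ball) hf2int fun x => ?_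
      refine Set.indicator_le' (fun y hy => ?_) (fun y _ => sq_nonneg _) x
      simp [hf, radialCutoff_eq_one hR0 (hx₀ y hy).1]
    refine le_trans ?_ hball
    have hfin : IsFiniteMeasure (volume.withDensity fun x =>
        ENNReal.ofReal (Z⁻¹ * (d x * Real.exp (V x)))) := hμV' ▸ inferInstance
    have hlow := le_withDensity_real (measurableSet_ball (x := x₀) (ε := R))
      (b := Z⁻¹ * (c * (5 * R) ^ (-((m : ℝ) + α)) * G)) (by positivity) (ν := volume)
      (w := fun x => Z⁻¹ * (d x * Real.exp (V x))) fun x hx => by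
        have := hx₀ x hx
        refine mul_le_mul_of_nonneg_left ?_ (by positivity)
        exact le_density_mul_exp_potential hφ_mono hεc1 hεc0 hc (by positivity) hR1
          (by linarith) this.2
    rw [← hμV'] at hlow
    refine le_trans (le_of_eq ?_) hlow
    have hvol : volume.real (Metric.ball x₀ R) = R ^ (m : ℝ) * ω := by
      rw [Measure.real, Measure.addHaar_ball_of_pos _ _ hR0, ENNReal.toReal_mul,
        ENNReal.toReal_ofReal (by positivity), finrank_euclideanSpace_fin, Real.rpow_natCast, hω,
        Measure.real]
    rw [hvol, hκ, Real.mul_rpow (by norm_num) hR0.le,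
      show R ^ (-α) = R ^ (-((m : ℝ) + α)) * R ^ (m : ℝ) by
        rw [← Real.rpow_add hR0]; ring_nf]
    ring
  have hcs := sq_integral_abs_le_of_tail hfint hf2int
    (measurableSet_le measurable_const measurable_norm)
    (fun x hx => radialCutoff_eq_zero hR0 (not_le.1 hx).le)
    (show 0 < K * R ^ (-(α / 2)) by positivity) htail
  set M : ℝ := ∫ x, f x ^ 2 ∂μV
  have hM0 : 0 < M := lt_of_lt_of_le (by positivity) hmass
  refine ⟨κ / (2 * Λ) * Real.log (5 * R) ^ (-(1 - εc)) *
    Real.exp (truncatedPerturbation φ εc R), by positivity, f, (hA f).2 ⟨hfc.measurable,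
      ⟨1, fun x => by rw [abs_of_nonneg (hf0 x)]; exact hf1 x⟩, ⟨_, hΓle⟩⟩, ?_⟩
  set r : ℝ := κ / (2 * Λ) * Real.log (5 * R) ^ (-(1 - εc)) *
    Real.exp (truncatedPerturbation φ εc R) with hr
  have hrE : r * EnV f ≤ M / 2 := by
    have hr0 : 0 ≤ r := by positivity
    calc r * EnV f ≤ r * (Λ * R ^ (-α)) := by gcongr
      _ = κ * R ^ (-α) * G / 2 := by
          rw [hr, hG]
          field_simp
      _ ≤ M / 2 := by linarith
  have hβ : Real.exp (C₁ * (1 + r ^ (-(1 / (1 - εc))))) * (∫ x, |f x| ∂μV) ^ 2 < M / 2 := by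
    calc _ ≤ Real.exp (C₁ * (1 + r ^ (-(1 / (1 - εc))))) * (K * R ^ (-(α / 2)) * M) := by gcongr
      _ = Real.exp (C₁ * (1 + r ^ (-(1 / (1 - εc))))) * (K * R ^ (-(α / 2))) * M := by ring
      _ < 1 / 2 * M := by gcongr
      _ = M / 2 := by ring
  linarith
end

section
/- Let m = 1, α ∈ (0,1), κ > 1. Let H > 4, L > κH^κ/(H−2), and define V(x) := K₀ + L ∑_{n=1}^∞ 1_{[nH,(n+1)H)}(x) (n+1)^{κ−1} (2n+1 − 2x/H), where K₀ ∈ ℝ is chosen so that ∫ e^V dμ = 1. Then V satisfies −C₁(1+|x|^{κ−1}) − K ≤ V(x) ≤ C₁(1+|x|^{κ−1}) + K for some constants C₁ > 0, K ∈ ℝ; however, the Poincaré inequality fails for every constant: for every C > 0 there exists f ∈ 𝒜 with μ_V(f²) − μ_V(f)² > C ℰ_V(f), where μ_V := e^V·μ and ℰ_V(f) := ∫ Γ(f) dμ_V. Equivalently, there is a sequence f_n ∈ 𝒜 with Var_{μ_V}(f_n) > 0 and ℰ_V(f_n)/Var_{μ_V}(f_n) → 0. -/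
open MeasureTheory Filter
open scoped ENNReal

/-- An upper bound on a density over `S` bounds the mass of `S`. -/
lemma withDensity_ofReal_le (μ : Measure ℝ) (g : ℝ → ℝ) {S : Set ℝ} (hS : MeasurableSet S)
    {b : ℝ} (h : ∀ x ∈ S, g x ≤ b) :
    μ.withDensity (fun x => ENNReal.ofReal (g x)) S ≤ ENNReal.ofReal b * μ S := by
  rw [withDensity_apply _ hS, ← setLIntegral_const]
  exact setLIntegral_mono' hS fun x hx => ENNReal.ofReal_le_ofReal (h x hx)

/-- A lower bound on a density over `S` bounds the mass of `S` from below. -/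
lemma le_withDensity_ofReal (μ : Measure ℝ) (g : ℝ → ℝ) {S : Set ℝ} (hS : MeasurableSet S)
    {b : ℝ} (h : ∀ x ∈ S, b ≤ g x) :
    ENNReal.ofReal b * μ S ≤ μ.withDensity (fun x => ENNReal.ofReal (g x)) S := by
  rw [withDensity_apply _ hS, ← setLIntegral_const]
  exact setLIntegral_mono' hS fun x hx => ENNReal.ofReal_le_ofReal (h x hx)

/-- The tangent line bound for the convex function `t ↦ t ^ κ`. -/
lemma rpow_sub_rpow_le {κ a b : ℝ} (hκ : 1 ≤ κ) (ha : 0 ≤ a) (hb : 0 < b) :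
    b ^ κ - a ^ κ ≤ κ * b ^ (κ - 1) * (b - a) := by
  have h1 := one_add_mul_self_le_rpow_one_add (s := a / b - 1) (by
    have : 0 ≤ a / b := by positivity
    linarith) hκ
  have h2 : a ^ κ = b ^ κ * (1 + (a / b - 1)) ^ κ := by
    rw [← Real.mul_rpow hb.le (by ring_nf; positivity)]
    congr 1
    field_simp
    ring
  have h3 : b ^ κ = b ^ (κ - 1) * b := by
    rw [← Real.rpow_add_one hb.ne']
    ring_nf
  have h4 : 0 < b ^ (κ - 1) := Real.rpow_pos_of_pos hb _
  have h5 : b ^ κ * (1 + κ * (a / b - 1)) ≤ a ^ κ := by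
    rw [h2]
    exact mul_le_mul_of_nonneg_left h1 (by positivity)
  have h6 : b ^ κ * (1 + κ * (a / b - 1)) = b ^ κ - κ * b ^ (κ - 1) * (b - a) := by
    rw [h3]
    field_simp
    ring
  linarith

/-- The piecewise linear function that is `0` below `a` and `1` above `a + η`. -/
noncomputable def ramp (a η x : ℝ) : ℝ := max 0 (min 1 ((x - a) / η))

lemma ramp_nonneg (a η x : ℝ) : 0 ≤ ramp a η x := le_max_left _ _

lemma ramp_le_one (a η x : ℝ) : ramp a η x ≤ 1 :=
  max_le zero_le_one (min_le_left _ _)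

lemma ramp_eq_zero {a η x : ℝ} (hη : 0 < η) (hx : x ≤ a) : ramp a η x = 0 :=
  max_eq_left ((min_le_right _ _).trans (div_nonpos_of_nonpos_of_nonneg (by linarith) hη.le))

lemma ramp_eq_one {a η x : ℝ} (hη : 0 < η) (hx : a + η ≤ x) : ramp a η x = 1 := by
  rw [ramp, min_eq_left ((one_le_div hη).2 (by linarith)), max_eq_right zero_le_one]

lemma continuous_ramp (a η : ℝ) : Continuous (ramp a η) := by
  unfold ramp
  fun_prop

lemma abs_ramp_sub_ramp_le {a η : ℝ} (hη : 0 < η) (x y : ℝ) :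
    |ramp a η x - ramp a η y| ≤ |x - y| / η := by
  have h1 := abs_max_sub_max_le_max 0 (min 1 ((x - a) / η)) 0 (min 1 ((y - a) / η))
  have h2 := abs_min_sub_min_le_max 1 ((x - a) / η) 1 ((y - a) / η)
  have h3 : (x - a) / η - (y - a) / η = (x - y) / η := by ring
  rw [h3, abs_div, abs_of_pos hη] at h2
  have h4 : 0 ≤ |x - y| / η := by positivity
  simp only [sub_self, abs_zero, max_eq_right h4] at h2
  simp only [sub_self, abs_zero] at h1
  exact h1.trans (max_le h4 h2)

/-- A function with values in `[0, 1]` that vanishes on `A` and equals `1` on `B` has variance at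
least the product of the masses of `A` and `B`. -/
lemma mul_le_variance (ν : Measure ℝ) [IsProbabilityMeasure ν] {f : ℝ → ℝ} (hf : Measurable f)
    (h0 : ∀ x, 0 ≤ f x) (h1 : ∀ x, f x ≤ 1) {A B : Set ℝ} (hA : MeasurableSet A)
    (hB : MeasurableSet B) (hfA : ∀ x ∈ A, f x = 0) (hfB : ∀ x ∈ B, f x = 1) :
    ν.real A * ν.real B ≤ (∫ x, f x ^ 2 ∂ν) - (∫ x, f x ∂ν) ^ 2 := by
  have hfi : Integrable f ν := Integrable.of_bound hf.aestronglyMeasurable 1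
    (ae_of_all _ fun x => by rw [Real.norm_of_nonneg (h0 x)]; exact h1 x)
  have hf2 : Integrable (fun x => f x ^ 2) ν :=
    Integrable.of_bound (hf.pow_const 2).aestronglyMeasurable 1
      (ae_of_all _ fun x => by
        rw [Real.norm_of_nonneg (sq_nonneg _)]
        exact pow_le_one₀ (h0 x) (h1 x))
  have hAB : Disjoint A B := by
    rw [Set.disjoint_left]
    intro x hxA hxB
    linarith [hfA x hxA, hfB x hxB]
  set m := ∫ x, f x ∂ν with hm
  have hsq : ∀ x, (f x - m) ^ 2 = f x ^ 2 - (2 * m * f x - m ^ 2) := fun x => by ring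
  have hlin : Integrable (fun x => 2 * m * f x - m ^ 2) ν :=
    (hfi.const_mul _).sub (integrable_const _)
  have e1 : ∫ x, (f x - m) ^ 2 ∂ν = (∫ x, f x ^ 2 ∂ν) - m ^ 2 := by
    simp_rw [hsq]
    rw [integral_sub hf2 hlin, integral_sub (hfi.const_mul _) (integrable_const _),
      integral_const_mul, ← hm]
    simp
    ring
  have hi : Integrable (fun x => (f x - m) ^ 2) ν := by
    simp_rw [hsq]
    exact hf2.sub hlin
  have e2 : ∫ x in A ∪ B, (f x - m) ^ 2 ∂ν = ν.real A * m ^ 2 + ν.real B * (1 - m) ^ 2 := by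
    rw [setIntegral_union hAB hB hi.integrableOn hi.integrableOn,
      setIntegral_congr_fun hA (g := fun _ => m ^ 2) (fun x hx => by simp [hfA x hx]),
      setIntegral_congr_fun hB (g := fun _ => (1 - m) ^ 2) (fun x hx => by simp [hfB x hx]),
      setIntegral_const, setIntegral_const]
    simp
  have e3 : ∫ x in A ∪ B, (f x - m) ^ 2 ∂ν ≤ ∫ x, (f x - m) ^ 2 ∂ν :=
    setIntegral_le_integral hi (ae_of_all _ fun x => sq_nonneg _)
  have e4 : ν.real A + ν.real B ≤ 1 := by
    rw [← measureReal_union hAB hB]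
    exact measureReal_le_one
  have ha : 0 ≤ ν.real A := measureReal_nonneg
  have hb : 0 ≤ ν.real B := measureReal_nonneg
  rw [e2, e1] at e3
  refine le_trans ?_ e3
  generalize ν.real A = a at *
  generalize ν.real B = b at *
  rcases (add_nonneg ha hb).eq_or_lt with h | h
  · have : a = 0 := by linarith
    have : b = 0 := by linarith
    subst_vars
    simp
  · nlinarith [sq_nonneg ((a + b) * m - b),
      mul_nonneg (add_nonneg (mul_nonneg ha (sq_nonneg m)) (mul_nonneg hb (sq_nonneg (1 - m))))
        (sub_nonneg.2 e4)]

/-- Below `H` every tooth of the sawtooth vanishes. -/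
lemma sawtooth_of_lt {κ H x : ℝ} (hH : 0 < H) (hx : x < H) :
    (∑' n : ℕ, (if ((n : ℝ) + 1) * H ≤ x ∧ x < ((n : ℝ) + 2) * H
        then ((n : ℝ) + 2) ^ (κ - 1) * (2 * ((n : ℝ) + 1) + 1 - 2 * x / H) else 0)) = 0 := by
  refine (tsum_congr fun n => ?_).trans tsum_zero
  rw [if_neg]
  rintro ⟨h, -⟩
  have : 0 ≤ (n : ℝ) * H := by positivity
  linarith

/-- On the `k`-th period only the `k`-th tooth of the sawtooth contributes. -/
lemma sawtooth_of_mem {κ H x : ℝ} (hH : 0 < H) (k : ℕ) (h1 : ((k : ℝ) + 1) * H ≤ x)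
    (h2 : x < ((k : ℝ) + 2) * H) :
    (∑' n : ℕ, (if ((n : ℝ) + 1) * H ≤ x ∧ x < ((n : ℝ) + 2) * H
        then ((n : ℝ) + 2) ^ (κ - 1) * (2 * ((n : ℝ) + 1) + 1 - 2 * x / H) else 0)) =
      ((k : ℝ) + 2) ^ (κ - 1) * (2 * ((k : ℝ) + 1) + 1 - 2 * x / H) := by
  rw [tsum_eq_single k, if_pos ⟨h1, h2⟩]
  intro n hn
  rw [if_neg]
  rintro ⟨h3, h4⟩
  apply hn
  have a1 : (n : ℝ) + 1 < k + 2 := lt_of_mul_lt_mul_right (h3.trans_lt h2) hH.le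
  have a2 : (k : ℝ) + 1 < n + 2 := lt_of_mul_lt_mul_right (h1.trans_lt h4) hH.le
  have a1' : n + 1 < k + 2 := by exact_mod_cast a1
  have a2' : k + 1 < n + 2 := by exact_mod_cast a2
  omega

/-- The sawtooth is dominated by `|x| ^ (κ - 1)`. -/
lemma abs_sawtooth_le {κ H : ℝ} (hκ : 1 < κ) (hH : 4 < H) (x : ℝ) :
    |∑' n : ℕ, (if ((n : ℝ) + 1) * H ≤ x ∧ x < ((n : ℝ) + 2) * H
        then ((n : ℝ) + 2) ^ (κ - 1) * (2 * ((n : ℝ) + 1) + 1 - 2 * x / H) else 0)| ≤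
      |x| ^ (κ - 1) := by
  have hH0 : 0 < H := by linarith
  rcases lt_or_ge x H with hx | hx
  · rw [sawtooth_of_lt hH0 hx, abs_zero]
    positivity
  · have hx1 : 1 ≤ x / H := (one_le_div hH0).2 hx
    obtain ⟨k, hk⟩ : ∃ k, ⌊x / H⌋₊ = k + 1 :=
      Nat.exists_eq_succ_of_ne_zero (Nat.floor_pos.2 hx1).ne'
    have f1 := Nat.floor_le (zero_le_one.trans hx1)
    have f2 := Nat.lt_floor_add_one (x / H)
    rw [hk] at f1 f2
    push_cast at f1 f2
    have g1 : ((k : ℝ) + 1) * H ≤ x := (le_div_iff₀ hH0).1 f1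
    have g2 : x < ((k : ℝ) + 2) * H := by
      have := (div_lt_iff₀ hH0).1 f2
      linarith
    have hk0 : (0 : ℝ) ≤ k := k.cast_nonneg
    rw [sawtooth_of_mem hH0 k g1 g2, abs_mul,
      abs_of_pos (by positivity : 0 < ((k : ℝ) + 2) ^ (κ - 1)), abs_of_pos (by linarith : 0 < x)]
    have b1 : |2 * ((k : ℝ) + 1) + 1 - 2 * x / H| ≤ 1 := by
      rw [abs_le, mul_div_assoc]
      constructor <;> linarith
    have b2 : ((k : ℝ) + 2) ^ (κ - 1) ≤ x ^ (κ - 1) :=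
      Real.rpow_le_rpow (by positivity) (by nlinarith) (by linarith)
    calc _ ≤ ((k : ℝ) + 2) ^ (κ - 1) * 1 := by gcongr
      _ ≤ _ := by linarith

/-- The carré du champ of a ramp with respect to the truncated stable kernel is bounded. -/
lemma carreDuChamp_ramp_le {α κ c η a : ℝ} (hα1 : α < 1) (hc : 0 < c) (hη : 0 < η)
    (x : ℝ) :
    (∫ y, (ramp a η x - ramp a η y) ^ 2 *
      (if |x - y| ≤ 1 then Real.exp (|y| ^ κ) / |x - y| ^ (1 + α) else 0)
      ∂(volume.withDensity fun x : ℝ => ENNReal.ofReal (c * Real.exp (-(|x| ^ κ))))) ≤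
      2 * c / η ^ 2 := by
  rw [integral_withDensity_eq_integral_toReal_smul (by fun_prop) (by simp)]
  have hint : ∫ y, (Set.Icc (x - 1) (x + 1)).indicator (fun _ => c / η ^ 2) y = 2 * c / η ^ 2 := by
    rw [integral_indicator measurableSet_Icc, setIntegral_const]
    simp only [measureReal_def, Real.volume_Icc, smul_eq_mul]
    rw [ENNReal.toReal_ofReal (by linarith)]
    ring
  rw [← hint]
  refine integral_mono_of_nonneg (ae_of_all _ fun y => ?_) ?_ (ae_of_all _ fun y => ?_)
  · simp only [Pi.zero_apply, smul_eq_mul]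
    positivity
  · exact (integrable_indicator_iff measurableSet_Icc).2 (integrableOn_const (by simp))
  · simp only [smul_eq_mul]
    by_cases hxy : |x - y| ≤ 1
    · have hmem : y ∈ Set.Icc (x - 1) (x + 1) := by
        rw [abs_le] at hxy
        constructor <;> linarith
      rw [if_pos hxy, Set.indicator_of_mem hmem, ENNReal.toReal_ofReal (by positivity)]
      have e1 : Real.exp (-(|y| ^ κ)) * Real.exp (|y| ^ κ) = 1 := by
        rw [← Real.exp_add]
        simp
      have e2 : (ramp a η x - ramp a η y) ^ 2 ≤ |x - y| ^ 2 / η ^ 2 := by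
        rw [← sq_abs, ← div_pow]
        exact pow_le_pow_left₀ (abs_nonneg _) (abs_ramp_sub_ramp_le hη x y) 2
      have e3 : |x - y| ^ 2 / |x - y| ^ (1 + α) ≤ 1 := by
        rcases (abs_nonneg (x - y)).eq_or_lt with h | h
        · rw [← h]
          simp
        · rw [div_le_one (by positivity), ← Real.rpow_two]
          exact Real.rpow_le_rpow_of_exponent_ge h hxy (by linarith)
      calc _ = c * (Real.exp (-(|y| ^ κ)) * Real.exp (|y| ^ κ)) *
            ((ramp a η x - ramp a η y) ^ 2 / |x - y| ^ (1 + α)) := by ring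
        _ = c * ((ramp a η x - ramp a η y) ^ 2 / |x - y| ^ (1 + α)) := by rw [e1, mul_one]
        _ ≤ c * ((|x - y| ^ 2 / η ^ 2) / |x - y| ^ (1 + α)) := by gcongr
        _ = c / η ^ 2 * (|x - y| ^ 2 / |x - y| ^ (1 + α)) := by ring
        _ ≤ c / η ^ 2 * 1 := by gcongr
        _ = _ := mul_one _
    · rw [if_neg hxy, mul_zero, mul_zero]
      exact Set.indicator_nonneg (fun _ _ => by positivity) _

/-- The threshold on `L` leaves room for a ramp of some positive width `η`. -/
lemma exists_ramp_width {κ H L : ℝ} (hH : 4 < H) (hL : κ * H ^ κ / (H - 2) < L) :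
    ∃ η, 0 < η ∧ η < 1 ∧
      0 < L * (2 - (4 + 4 * η) / H) - κ * (H + η) ^ (κ - 1) * (2 + 2 * η) := by
  have hH0 : 0 < H := by linarith
  have hcont : ContinuousAt
      (fun η : ℝ => L * (2 - (4 + 4 * η) / H) - κ * (H + η) ^ (κ - 1) * (2 + 2 * η)) 0 := by
    have : ContinuousAt (fun η : ℝ => (H + η) ^ (κ - 1)) 0 :=
      ContinuousAt.rpow_const (by fun_prop) (Or.inl (by simpa using hH0.ne'))
    fun_prop
  have h0 : 0 < L * (2 - (4 + 4 * (0 : ℝ)) / H) - κ * (H + 0) ^ (κ - 1) * (2 + 2 * 0) := by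
    rw [div_lt_iff₀ (by linarith)] at hL
    have h3 : H ^ κ = H ^ (κ - 1) * H := by
      rw [← Real.rpow_add_one hH0.ne']
      ring_nf
    rw [h3] at hL
    have : L * (2 - (4 + 4 * (0 : ℝ)) / H) - κ * (H + 0) ^ (κ - 1) * (2 + 2 * 0) =
        2 / H * (L * (H - 2) - κ * (H ^ (κ - 1) * H)) := by
      rw [add_zero]
      field_simp
      ring
    rw [this]
    have : 0 < L * (H - 2) - κ * (H ^ (κ - 1) * H) := by linarith
    positivity
  obtain ⟨η, h1, h2⟩ := (((hcont.eventually (lt_mem_nhds h0)).filter_mono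
    nhdsWithin_le_nhds).and (Ioo_mem_nhdsGT (zero_lt_one (α := ℝ)))).exists
  exact ⟨η, h2.1, h2.2, h1⟩

/-- The exponent of the density at the peak right of `N * H` exceeds the one in the valley left of
it by a multiple of `N ^ (κ - 1)`. -/
lemma exponent_gap {κ H L η N : ℝ} (hκ : 1 < κ) (hH : 4 < H) (hη0 : 0 < η) (hη1 : η < 1)
    (hN : 1 ≤ N) :
    (L * (2 - (4 + 4 * η) / H) - κ * (H + η) ^ (κ - 1) * (2 + 2 * η)) * N ^ (κ - 1) ≤
      (L * (N ^ (κ - 1) * (1 - 2 * η / H)) - (N * H + η) ^ κ) -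
        (L * (N ^ (κ - 1) * (-1 + 2 * (2 + η) / H)) - (N * H - 2 - η) ^ κ) := by
  have h1 := rpow_sub_rpow_le (κ := κ) (a := N * H - 2 - η) (b := N * H + η) hκ.le
    (by nlinarith) (by nlinarith)
  have h2 : (N * H + η) ^ (κ - 1) ≤ N ^ (κ - 1) * (H + η) ^ (κ - 1) := by
    rw [← Real.mul_rpow (by linarith) (by linarith)]
    exact Real.rpow_le_rpow (by nlinarith) (by nlinarith) (by linarith)
  have h3 : κ * (N * H + η) ^ (κ - 1) * (N * H + η - (N * H - 2 - η)) ≤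
      κ * (N ^ (κ - 1) * (H + η) ^ (κ - 1)) * (2 + 2 * η) := by
    rw [show N * H + η - (N * H - 2 - η) = 2 + 2 * η by ring]
    gcongr
  have h4 : L * (N ^ (κ - 1) * (1 - 2 * η / H)) - L * (N ^ (κ - 1) * (-1 + 2 * (2 + η) / H)) =
      L * (2 - (4 + 4 * η) / H) * N ^ (κ - 1) := by ring
  linarith

/-- Proposition 2.5: a sawtooth potential with κ-growth for which the Poincaré inequality fails. -/
theorem example_gaussWeight_poincare_fails
    (α κ : ℝ) (hα0 : 0 < α) (hα1 : α < 1) (hκ : 1 < κ)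
    (c : ℝ) (hc : 0 < c)
    (μ : MeasureTheory.Measure ℝ)
    (hμ : μ = MeasureTheory.volume.withDensity fun x : ℝ =>
      ENNReal.ofReal (c * Real.exp (-(|x| ^ κ))))
    [MeasureTheory.IsProbabilityMeasure μ]
    (q : ℝ → ℝ → ℝ)
    (hq : ∀ x y, q x y = if |x - y| ≤ 1 then Real.exp (|y| ^ κ) / |x - y| ^ (1 + α) else 0)
    (Γ : (ℝ → ℝ) → ℝ → ℝ)
    (hΓ : ∀ f x, Γ f x = ∫ y, (f x - f y) ^ 2 * q x y ∂μ)
    (A : Set (ℝ → ℝ))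
    (hA : ∀ f, f ∈ A ↔ Measurable f ∧ (∃ M, ∀ x, |f x| ≤ M) ∧ ∃ M, ∀ x, Γ f x ≤ M)
    (H L K₀ : ℝ) (hH : 4 < H) (hL : κ * H ^ κ / (H - 2) < L)
    (V : ℝ → ℝ)
    (hV : ∀ x, V x = K₀ + L * ∑' n : ℕ,
      (if ((n : ℝ) + 1) * H ≤ x ∧ x < ((n : ℝ) + 2) * H
        then ((n : ℝ) + 2) ^ (κ - 1) * (2 * ((n : ℝ) + 1) + 1 - 2 * x / H) else 0))
    (hV_norm : ∫ x, Real.exp (V x) ∂μ = 1)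
    (μV : MeasureTheory.Measure ℝ)
    (hμV : μV = μ.withDensity fun x => ENNReal.ofReal (Real.exp (V x)))
    (EnV : (ℝ → ℝ) → ℝ)
    (hEnV : ∀ f, EnV f = ∫ x, Γ f x ∂μV) :
    (∃ C₁ : ℝ, 0 < C₁ ∧ ∃ K : ℝ,
      ∀ x, -(C₁ * (1 + |x| ^ (κ - 1))) - K ≤ V x ∧ V x ≤ C₁ * (1 + |x| ^ (κ - 1)) + K)
    ∧
    (∀ C : ℝ, 0 < C → ∃ f ∈ A,
      C * EnV f < (∫ x, f x ^ 2 ∂μV) - (∫ x, f x ∂μV) ^ 2)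
    ∧
    (∃ F : ℕ → (ℝ → ℝ), (∀ n, F n ∈ A) ∧
      (∀ n, 0 < (∫ x, F n x ^ 2 ∂μV) - (∫ x, F n x ∂μV) ^ 2) ∧
      Tendsto (fun n => EnV (F n) / ((∫ x, F n x ^ 2 ∂μV) - (∫ x, F n x ∂μV) ^ 2))
        atTop (nhds 0)) := by
  have hH0 : 0 < H := by linarith
  have hL0 : 0 < L := lt_of_le_of_lt (by
    have : 0 < H - 2 := by linarith
    positivity) hL
  refine ⟨⟨L, hL0, |K₀|, fun x => ?_⟩, ?_⟩
  · have h1 := abs_le.1 (abs_sawtooth_le hκ hH x)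
    have h2 := abs_le.1 (le_refl |K₀|)
    rw [hV]
    constructor
    · linarith [mul_le_mul_of_nonneg_left h1.1 hL0.le]
    · linarith [mul_le_mul_of_nonneg_left h1.2 hL0.le]
  rw [and_iff_right_of_imp]
  swap
  · rintro ⟨F, hFA, hFpos, hF⟩ C hC
    obtain ⟨n, hn⟩ := (hF.eventually (gt_mem_nhds (inv_pos.2 hC))).exists
    refine ⟨F n, hFA n, ?_⟩
    rw [div_lt_iff₀ (hFpos n), lt_inv_mul_iff₀ hC] at hn
    exact hn
  obtain ⟨η, hη0, hη1, hθ⟩ := exists_ramp_width hH hL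
  set θ := L * (2 - (4 + 4 * η) / H) - κ * (H + η) ^ (κ - 1) * (2 + 2 * η)
  have hVint : Integrable (fun x => Real.exp (V x)) μ := by
    by_contra h
    rw [integral_undef h] at hV_norm
    exact zero_ne_one hV_norm
  have hprob : IsProbabilityMeasure μV := by
    constructor
    rw [hμV, withDensity_apply _ MeasurableSet.univ, Measure.restrict_univ,
      ← ofReal_integral_eq_lintegral_ofReal hVint (ae_of_all _ fun x => (Real.exp_pos _).le),
      hV_norm, ENNReal.ofReal_one]
  have hupper : ∀ (S : Set ℝ) (v w : ℝ), MeasurableSet S → (∀ x ∈ S, V x ≤ v) →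
      (∀ x ∈ S, w ≤ |x| ^ κ) → volume S ≠ ∞ →
      μV.real S ≤ c * Real.exp (v - w) * volume.real S := by
    intro S v w hS hv hw hfin
    have h1 := withDensity_ofReal_le μ (fun x => Real.exp (V x)) hS
      (b := Real.exp v) (fun x hx => Real.exp_le_exp.2 (hv x hx))
    have h2 := withDensity_ofReal_le volume (fun x => c * Real.exp (-(|x| ^ κ))) hS
      (b := c * Real.exp (-w)) (fun x hx => by have := hw x hx; gcongr)
    rw [← hμV] at h1
    rw [← hμ] at h2
    have h3 := h1.trans (mul_le_mul_right h2 _)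
    have h4 := ENNReal.toReal_mono (ENNReal.mul_ne_top ENNReal.ofReal_ne_top
      (ENNReal.mul_ne_top ENNReal.ofReal_ne_top hfin)) h3
    rw [ENNReal.toReal_mul, ENNReal.toReal_mul, ENNReal.toReal_ofReal (by positivity),
      ENNReal.toReal_ofReal (by positivity)] at h4
    rw [sub_eq_add_neg, Real.exp_add]
    exact h4.trans_eq (by simp only [measureReal_def]; ring)
  have hlower : ∀ (S : Set ℝ) (v w : ℝ), MeasurableSet S → (∀ x ∈ S, v ≤ V x) →
      (∀ x ∈ S, |x| ^ κ ≤ w) →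
      c * Real.exp (v - w) * volume.real S ≤ μV.real S := by
    intro S v w hS hv hw
    have h1 := le_withDensity_ofReal μ (fun x => Real.exp (V x)) hS
      (b := Real.exp v) (fun x hx => Real.exp_le_exp.2 (hv x hx))
    have h2 := le_withDensity_ofReal volume (fun x => c * Real.exp (-(|x| ^ κ))) hS
      (b := c * Real.exp (-w)) (fun x hx => by have := hw x hx; gcongr)
    rw [← hμV] at h1
    rw [← hμ] at h2
    have h3 := (mul_le_mul_right h2 _).trans h1
    have h4 := ENNReal.toReal_mono (measure_ne_top μV S) h3
    rw [ENNReal.toReal_mul, ENNReal.toReal_mul, ENNReal.toReal_ofReal (by positivity),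
      ENNReal.toReal_ofReal (by positivity)] at h4
    rw [sub_eq_add_neg, Real.exp_add]
    exact le_trans (le_of_eq (by simp only [measureReal_def]; ring)) h4
  set m₀ := μV.real (Set.Icc 0 1)
  have hm₀pos : 0 < m₀ := by
    refine lt_of_lt_of_le ?_ (hlower (Set.Icc 0 1) K₀ 1 measurableSet_Icc (fun x hx => ?_)
      (fun x hx => ?_))
    · simp only [measureReal_def, Real.volume_Icc]
      norm_num
      positivity
    · rw [hV, sawtooth_of_lt hH0 (by linarith [hx.2]), mul_zero, add_zero]
    · rw [abs_of_nonneg hx.1]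
      exact Real.rpow_le_one hx.1 hx.2 (by linarith)
  let N : ℕ → ℝ := fun n => (n : ℝ) + 2
  have hN2 : ∀ n, 2 ≤ N n := fun n => by
    have : (0 : ℝ) ≤ n := n.cast_nonneg
    simp only [N]
    linarith
  let F : ℕ → ℝ → ℝ := fun n => ramp (N n * H - 1 - η) η
  let valley : ℕ → ℝ := fun n =>
    L * (N n ^ (κ - 1) * (-1 + 2 * (2 + η) / H)) - (N n * H - 2 - η) ^ κ
  let peak : ℕ → ℝ := fun n =>
    L * (N n ^ (κ - 1) * (1 - 2 * η / H)) - (N n * H + η) ^ κ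
  have hgap : ∀ n, θ * N n ^ (κ - 1) ≤ peak n - valley n := fun n =>
    exponent_gap hκ hH hη0 hη1 (by linarith [hN2 n])
  have hΓnonneg : ∀ f x, 0 ≤ Γ f x := by
    intro f x
    rw [hΓ]
    refine integral_nonneg fun y => ?_
    simp only [Pi.zero_apply, hq]
    positivity
  have hΓle : ∀ n x, Γ (F n) x ≤ 2 * c / η ^ 2 := by
    intro n x
    rw [hΓ, hμ]
    simp_rw [hq]
    exact carreDuChamp_ramp_le hα1 hc hη0 x
  have hΓzero : ∀ n x, x ∉ Set.Ico (N n * H - 2 - η) (N n * H) → Γ (F n) x = 0 := by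
    intro n x hx
    rw [hΓ]
    refine integral_eq_zero_of_ae (ae_of_all _ fun y => ?_)
    simp only [Pi.zero_apply, hq, F]
    split_ifs with hxy
    · rw [abs_le] at hxy
      rcases lt_or_ge x (N n * H - 2 - η) with h | h
      · rw [ramp_eq_zero hη0 (by linarith), ramp_eq_zero hη0 (by linarith)]
        simp
      · have h' : N n * H ≤ x := not_lt.1 fun h' => hx ⟨h, h'⟩
        rw [ramp_eq_one hη0 (by linarith), ramp_eq_one hη0 (by linarith)]
        simp
    · simp
  have hFA : ∀ n, F n ∈ A := fun n => (hA _).2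
    ⟨(continuous_ramp _ _).measurable,
      ⟨1, fun x => by
        rw [abs_of_nonneg (ramp_nonneg _ _ _)]
        exact ramp_le_one _ _ _⟩,
      ⟨_, hΓle n⟩⟩
  have hEle : ∀ n, EnV (F n) ≤
      2 * c / η ^ 2 * (c * Real.exp (K₀ + valley n) * (2 + η)) := by
    intro n
    have hNH : 8 < N n * H := by nlinarith [hN2 n]
    have h1 : EnV (F n) ≤ 2 * c / η ^ 2 * μV.real (Set.Ico (N n * H - 2 - η) (N n * H)) := by
      rw [hEnV]
      have h2 : ∫ x, (Set.Ico (N n * H - 2 - η) (N n * H)).indicator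
          (fun _ => 2 * c / η ^ 2) x ∂μV =
          2 * c / η ^ 2 * μV.real (Set.Ico (N n * H - 2 - η) (N n * H)) := by
        rw [integral_indicator measurableSet_Ico, setIntegral_const, smul_eq_mul, mul_comm]
      rw [← h2]
      refine integral_mono_of_nonneg (ae_of_all _ (hΓnonneg _)) ?_ (ae_of_all _ fun x => ?_)
      · exact (integrable_const _).indicator measurableSet_Ico
      · by_cases hx : x ∈ Set.Ico (N n * H - 2 - η) (N n * H)
        · rw [Set.indicator_of_mem hx]
          exact hΓle n x
        · rw [Set.indicator_of_notMem hx]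
          exact (hΓzero n x hx).le
    have h3 := hupper (Set.Ico (N n * H - 2 - η) (N n * H))
      (K₀ + L * (N n ^ (κ - 1) * (-1 + 2 * (2 + η) / H))) ((N n * H - 2 - η) ^ κ)
      measurableSet_Ico (fun x hx => ?_) (fun x hx => ?_) (by simp)
    · refine h1.trans (mul_le_mul_of_nonneg_left ?_ (by positivity))
      refine h3.trans_eq ?_
      rw [measureReal_def, Real.volume_Ico, ENNReal.toReal_ofReal (by linarith)]
      simp only [valley]
      rw [add_sub_assoc]
      ring
    · have e1 : ((n : ℝ) + 1) * H ≤ x := by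
        have := hx.1
        simp only [N] at this
        linarith
      rw [hV, sawtooth_of_mem hH0 n e1 hx.2]
      have e2 : 2 * ((n : ℝ) + 1) + 1 - 2 * x / H ≤ -1 + 2 * (2 + η) / H := by
        have : (N n * H - 2 - η) / H ≤ x / H := div_le_div_of_nonneg_right hx.1 hH0.le
        have e3 : (N n * H - 2 - η) / H = n + 2 - (2 + η) / H := by
          simp only [N]
          field_simp
          ring
        rw [e3] at this
        rw [mul_div_assoc, mul_div_assoc]
        linarith
      have e4 : 0 ≤ N n ^ (κ - 1) := Real.rpow_nonneg (by linarith [hN2 n]) _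
      have := mul_le_mul_of_nonneg_left (mul_le_mul_of_nonneg_left e2 e4) hL0.le
      exact add_le_add_right this K₀
    · rw [abs_of_nonneg (by linarith [hx.1])]
      exact Real.rpow_le_rpow (by linarith) hx.1 (by linarith)
  have hVarge : ∀ n, m₀ * (c * Real.exp (K₀ + peak n) * η) ≤
      (∫ x, F n x ^ 2 ∂μV) - (∫ x, F n x ∂μV) ^ 2 := by
    intro n
    have hNH : 8 < N n * H := by nlinarith [hN2 n]
    have h1 := mul_le_variance μV (continuous_ramp (N n * H - 1 - η) η).measurable
      (ramp_nonneg _ _) (ramp_le_one _ _) (A := Set.Icc 0 1)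
      (B := Set.Icc (N n * H) (N n * H + η)) measurableSet_Icc measurableSet_Icc
      (fun x hx => ramp_eq_zero hη0 (by linarith [hx.2]))
      (fun x hx => ramp_eq_one hη0 (by linarith [hx.1]))
    refine le_trans (mul_le_mul_of_nonneg_left ?_ hm₀pos.le) h1
    have h3 := hlower (Set.Icc (N n * H) (N n * H + η))
      (K₀ + L * (N n ^ (κ - 1) * (1 - 2 * η / H))) ((N n * H + η) ^ κ)
      measurableSet_Icc (fun x hx => ?_) (fun x hx => ?_)
    · refine le_trans (le_of_eq ?_) h3
      rw [measureReal_def, Real.volume_Icc, ENNReal.toReal_ofReal (by linarith)]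
      simp only [peak]
      rw [add_sub_assoc]
      ring
    · have e0 : (((n + 1 : ℕ) : ℝ) + 1) = N n := by
        simp only [N]
        push_cast
        ring
      have e0' : (((n + 1 : ℕ) : ℝ) + 2) = N n + 1 := by
        simp only [N]
        push_cast
        ring
      rw [hV, sawtooth_of_mem hH0 (n + 1) (by rw [e0]; exact hx.1)
        (by rw [e0']; linarith [hx.2]), e0, e0']
      have e2 : 1 - 2 * η / H ≤ 2 * N n + 1 - 2 * x / H := by
        have : x / H ≤ (N n * H + η) / H := div_le_div_of_nonneg_right hx.2 hH0.le
        have e3 : (N n * H + η) / H = N n + η / H := by field_simp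
        rw [e3] at this
        rw [mul_div_assoc, mul_div_assoc]
        linarith
      have e4 : N n ^ (κ - 1) ≤ (N n + 1) ^ (κ - 1) :=
        Real.rpow_le_rpow (by linarith [hN2 n]) (by linarith) (by linarith)
      have e5 : 0 ≤ 1 - 2 * η / H := by
        rw [sub_nonneg, div_le_one hH0]
        linarith
      have e6 : 0 ≤ N n ^ (κ - 1) := Real.rpow_nonneg (by linarith [hN2 n]) _
      have := mul_le_mul_of_nonneg_left (mul_le_mul e4 e2 e5 (e6.trans e4)) hL0.le
      exact add_le_add_right this K₀
    · rw [abs_of_nonneg (by linarith [hx.1])]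
      exact Real.rpow_le_rpow (by linarith [hx.1]) hx.2 (by linarith)
  have hVarpos : ∀ n, 0 < (∫ x, F n x ^ 2 ∂μV) - (∫ x, F n x ∂μV) ^ 2 := fun n =>
    lt_of_lt_of_le (by positivity) (hVarge n)
  refine ⟨F, hFA, hVarpos, ?_⟩
  set D := 2 * c / η ^ 2 * (2 + η) / (m₀ * η) with hD
  have hratio : ∀ n, EnV (F n) / ((∫ x, F n x ^ 2 ∂μV) - (∫ x, F n x ∂μV) ^ 2) ≤
      D * Real.exp (-(θ * N n ^ (κ - 1))) := by
    intro n
    rw [div_le_iff₀ (hVarpos n)]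
    have h1 : Real.exp (K₀ + valley n) ≤
        Real.exp (-(θ * N n ^ (κ - 1))) * Real.exp (K₀ + peak n) := by
      rw [← Real.exp_add]
      exact Real.exp_le_exp.2 (by linarith [hgap n])
    calc EnV (F n) ≤ 2 * c / η ^ 2 * (c * Real.exp (K₀ + valley n) * (2 + η)) := hEle n
      _ ≤ 2 * c / η ^ 2 * (c * (Real.exp (-(θ * N n ^ (κ - 1))) * Real.exp (K₀ + peak n)) *
          (2 + η)) := by gcongr
      _ = D * Real.exp (-(θ * N n ^ (κ - 1))) * (m₀ * (c * Real.exp (K₀ + peak n) * η)) := by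
          rw [hD]
          field_simp
      _ ≤ _ := mul_le_mul_of_nonneg_left (hVarge n) (by positivity)
  have hNtop : Tendsto (fun n => θ * N n ^ (κ - 1)) atTop atTop :=
    ((tendsto_rpow_atTop (by linarith : 0 < κ - 1)).comp
      (tendsto_atTop_add_const_right _ _ tendsto_natCast_atTop_atTop)).const_mul_atTop hθ
  have hlim : Tendsto (fun n => D * Real.exp (-(θ * N n ^ (κ - 1)))) atTop (nhds 0) := by
    simpa using (Real.tendsto_exp_neg_atTop_nhds_zero.comp hNtop).const_mul D
  refine squeeze_zero (fun n => div_nonneg ?_ (hVarpos n).le) hratio hlim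
  rw [hEnV]
  exact integral_nonneg (hΓnonneg _)
end
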